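/- For every matching σ of Fin 6, the set P_σ = {x : Fin 6 → ℂ | x a + x (σ a) = 0 for all a} is a ℂ-linear subspace of dimension 3, and every x ∈ P_σ satisfies x₀ + x₁ + ⋯ + x₅ = 0 and x₀³ + x₁³ + ⋯ + x₅³ = 0; thus the projectivization of P_σ is one of the fifteen planes contained in the Segre cubic primal. -/

import Mathlib

/-- A matching of `Fin 6`: a fixed-point-free involution. -/
def IsMatching (σ : Equiv.Perm (Fin 6)) : Prop :=
  (∀ x, σ (σ x) = x) ∧ ∀ x, σ x ≠ x

/-- The subspace `P_σ`. -/
def matchingPlane (σ : Equiv.Perm (Fin 6)) : Submodule ℂ (Fin 6 → ℂ) where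
  carrier := {x | ∀ a, x a + x (σ a) = 0}
  add_mem' := by
    intro x y hx hy a
    have h1 := hx a
    have h2 := hy a
    simp only [Pi.add_apply]
    linear_combination h1 + h2
  zero_mem' := by intro a; simp
  smul_mem' := by
    intro c x hx a
    have h1 := hx a
    simp only [Pi.smul_apply, smul_eq_mul]
    linear_combination c * h1

/-- Exactly three elements are the smaller element of their pair. -/
lemma card_smaller (σ : Equiv.Perm (Fin 6)) (hσ : IsMatching σ) :
    Fintype.card {a : Fin 6 // a < σ a} = 3 := by
  have e : {a : Fin 6 // a < σ a} ≃ {a : Fin 6 // ¬ a < σ a} :=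
    σ.subtypeEquiv (fun a => by
      rw [hσ.1 a, not_lt]
      exact ⟨le_of_lt, fun h => lt_of_le_of_ne h (hσ.2 a).symm⟩)
  have h1 := Fintype.card_congr e
  have h2 := Fintype.card_subtype_compl (fun a : Fin 6 => a < σ a)
  have h3 := Fintype.card_subtype_le (fun a : Fin 6 => a < σ a)
  simp only [Fintype.card_fin] at h2 h3
  omega

/-- Restriction to the smaller elements is an isomorphism. -/
noncomputable def planeEquiv (σ : Equiv.Perm (Fin 6)) (hσ : IsMatching σ) :
    matchingPlane σ ≃ₗ[ℂ] ({a : Fin 6 // a < σ a} → ℂ) := by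
  refine LinearEquiv.ofBijective
    ((LinearMap.funLeft ℂ ℂ (fun a : {a : Fin 6 // a < σ a} => a.1)).comp
      (matchingPlane σ).subtype) ⟨?_, ?_⟩
  · rw [injective_iff_map_eq_zero]
    rintro ⟨x, hx⟩ h
    have h0 : ∀ a, a < σ a → x a = 0 := fun a ha => congrFun h ⟨a, ha⟩
    ext a
    change x a = 0
    rcases lt_or_gt_of_ne (hσ.2 a) with ha | ha
    · have h1 : x (σ a) = 0 := h0 (σ a) (by rwa [hσ.1])
      have h2 : x a + x (σ a) = 0 := hx a
      rwa [h1, add_zero] at h2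
    · exact h0 a ha
  · intro y
    have hl : ∀ a, ¬ a < σ a → σ a < σ (σ a) := fun a h => by
      rw [hσ.1]
      exact lt_of_le_of_ne (not_lt.mp h) (hσ.2 a)
    refine ⟨⟨fun a => if h : a < σ a then y ⟨a, h⟩ else - y ⟨σ a, hl a h⟩, ?_⟩, ?_⟩
    · intro a
      by_cases h : a < σ a
      · have h' : ¬ σ a < σ (σ a) := by rw [hσ.1]; exact h.asymm
        simp [h, h.asymm, hσ.1]
      · have h' := hl a h
        simp only [dif_neg h, dif_pos h']
        ring
    · ext ⟨a, ha⟩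
      simp [LinearMap.funLeft_apply, ha]

/-- An odd function summed over the pairs vanishes. -/
lemma sum_eq_zero_of_pairs (σ : Equiv.Perm (Fin 6)) (f : Fin 6 → ℂ)
    (hf : ∀ a, f a + f (σ a) = 0) : ∑ a, f a = 0 := by
  have h1 : ∑ a, f (σ a) = ∑ a, f a := Equiv.sum_comp σ f
  have h2 : ∑ a, (f a + f (σ a)) = 0 := Finset.sum_eq_zero fun a _ => hf a
  rw [Finset.sum_add_distrib, h1] at h2
  linear_combination h2 / 2

/-- For every matching `σ` of `Fin 6`, the set `{x | x a + x (σ a) = 0 for all a}` is a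
3-dimensional linear subspace of `ℂ⁶`, all of whose points lie on the Segre cubic primal
`x₀ + ⋯ + x₅ = 0`, `x₀³ + ⋯ + x₅³ = 0`. -/
theorem matching_plane_in_segre_cubic (σ : Equiv.Perm (Fin 6)) (hσ : IsMatching σ) :
    ∃ P : Submodule ℂ (Fin 6 → ℂ),
      (P : Set (Fin 6 → ℂ)) = {x : Fin 6 → ℂ | ∀ a, x a + x (σ a) = 0} ∧
      Module.finrank ℂ P = 3 ∧
      ∀ x : Fin 6 → ℂ, (∀ a, x a + x (σ a) = 0) →
        (∑ a, x a) = 0 ∧ (∑ a, (x a) ^ 3) = 0 := by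
  refine ⟨matchingPlane σ, rfl, ?_, fun x hx => ⟨sum_eq_zero_of_pairs σ x hx,
    sum_eq_zero_of_pairs σ (fun a => x a ^ 3) fun a => ?_⟩⟩
  · rw [(planeEquiv σ hσ).finrank_eq, Module.finrank_fintype_fun_eq_card, card_smaller σ hσ]
  · have h : x (σ a) = - x a := by linear_combination hx a
    simp only [h]
    ring
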